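/- arXiv:2512.23818 — 5 statements merged into one kernel-verified Lean document; each statement's English description precedes it below -/
import Mathlib

section
/- Let Σ be a symmetric positive definite n×n matrix, V : [0,∞) → ℝ differentiable on (0,∞), and let q(u) = Z⁻¹ exp(−V(‖u‖_{Σ⁻¹})) be an elliptical probability density on ℝⁿ (Z a finite normalizing constant). Let p be a probability density on ℝⁿ, m(y) = ∫ p(x) q(y−x) dx, and fix y with m(y) > 0. Assume differentiation under the integral sign is valid at y (m is differentiable at y with ∇m(y) = ∫ p(x) ∇q(y−x) dx) and that ∫ ‖∇_y V(‖y−x‖_{Σ⁻¹})‖ · p(x) q(y−x)/m(y) dx < ∞. Then the Tweedie-like formula for elliptical noise holds: ∇ log m(y) = −∫ ∇_{y′} V(‖y′−x‖_{Σ⁻¹})|_{y′=y} · [p(x) q(y−x)/m(y)] dx; that is, the score at y equals the negative fixed-measure (path) gradient in y of the posterior expectation of the potential V(‖y−X‖_{Σ⁻¹}). -/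
open MeasureTheory Matrix

noncomputable section

/-- Mahalanobis norm `‖u‖_{S} = √(uᵀ S u)` (applied with `S = Σ⁻¹`). -/
def mahNorm {n : ℕ} (S : Matrix (Fin n) (Fin n) ℝ) (u : EuclideanSpace ℝ (Fin n)) : ℝ :=
  Real.sqrt ((u : Fin n → ℝ) ⬝ᵥ S.mulVec u)

/-- The gradient of `c * exp (-W)` is `-(c * exp (-W)) • ∇W`, whether or not `W` is
differentiable. -/
theorem gradient_const_mul_exp_neg {E : Type*} [NormedAddCommGroup E] [InnerProductSpace ℝ E]
    [CompleteSpace E] {c : ℝ} (hc : c ≠ 0) (W : E → ℝ) (u : E) :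
    gradient (fun v => c * Real.exp (-W v)) u = -((c * Real.exp (-W u)) • gradient W u) := by
  by_cases hW : DifferentiableAt ℝ W u
  · have h : HasFDerivAt (fun v => c * Real.exp (-W v))
        (c • Real.exp (-W u) • -fderiv ℝ W u) u :=
      (hW.hasFDerivAt.neg.exp).const_mul c
    simp [gradient, h.fderiv, smul_smul]
  · have hexp : ¬ DifferentiableAt ℝ (fun v => c * Real.exp (-W v)) u := fun h => hW <| by
      have hlog := ((h.const_mul c⁻¹).log (by simp [hc])).neg
      simpa [inv_mul_cancel_left₀ hc, Pi.neg_def] using hlog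
    simp [gradient_eq_zero_of_not_differentiableAt hexp,
      gradient_eq_zero_of_not_differentiableAt hW]

theorem gradient_comp_sub_const {E : Type*} [NormedAddCommGroup E] [InnerProductSpace ℝ E]
    [CompleteSpace E] (f : E → ℝ) (a u : E) :
    gradient (fun v => f (v - a)) u = gradient f (u - a) := by
  simp only [gradient, fderiv_comp_sub]

/-- **Tweedie-like formula for elliptical noise.** For an elliptical noise density
`q(u) = Z⁻¹ exp(-V(‖u‖_{Σ⁻¹}))`, a clean density `p`, noisy marginal
`m(y) = ∫ p(x) q(y-x) dx` positive at `y`, assuming differentiation under the integral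
sign at `y` and posterior integrability of the potential gradient, the score of the noisy
marginal equals the negative fixed-measure (path) gradient of the posterior expectation of
the potential. -/
theorem elliptical_tweedie
    {n : ℕ} (Sig : Matrix (Fin n) (Fin n) ℝ) (hSig : Sig.PosDef)
    (V : ℝ → ℝ) (hV : ∀ r : ℝ, 0 < r → DifferentiableAt ℝ V r)
    (Z : ℝ) (hZ : 0 < Z)
    (q : EuclideanSpace ℝ (Fin n) → ℝ)
    (hq : ∀ u, q u = Z⁻¹ * Real.exp (-(V (mahNorm Sig⁻¹ u))))
    (hq_int : ∫ u, q u = 1)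
    (p : EuclideanSpace ℝ (Fin n) → ℝ)
    (hp_nonneg : ∀ x, 0 ≤ p x) (hp_int : ∫ x, p x = 1)
    (m : EuclideanSpace ℝ (Fin n) → ℝ)
    (hm : ∀ z, m z = ∫ x, p x * q (z - x))
    (y : EuclideanSpace ℝ (Fin n)) (hmy : 0 < m y)
    (hDUI : HasGradientAt m (∫ x, p x • gradient q (y - x)) y)
    (hInt : Integrable fun x =>
      ‖gradient (fun z => V (mahNorm Sig⁻¹ (z - x))) y‖ * (p x * q (y - x) / m y)) :
    gradient (fun z => Real.log (m z)) y
      = -∫ x, (p x * q (y - x) / m y) • gradient (fun z => V (mahNorm Sig⁻¹ (z - x))) y := by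
  have hlog : HasGradientAt (fun z => Real.log (m z))
      ((m y)⁻¹ • ∫ x, p x • gradient q (y - x)) y := by
    have h := hDUI.hasFDerivAt.log hmy.ne'
    rw [hasGradientAt_iff_hasFDerivAt]
    simpa using h
  rw [hlog.gradient, ← integral_smul, ← integral_neg]
  congr 1
  funext x
  rw [gradient_comp_sub_const (fun u => V (mahNorm Sig⁻¹ u)), funext hq,
    gradient_const_mul_exp_neg (inv_ne_zero hZ.ne') (fun u => V (mahNorm Sig⁻¹ u))]
  simp only [smul_neg, smul_smul]
  congr 2
  ring
end
end

section
/- Let λ > 0 and let q(u) = Z⁻¹ exp(−λ‖u‖₂) be the isotropic multivariate Laplace density on ℝⁿ. Let p be a probability density, m(y) = ∫ p(x) q(y−x) dx, fix y with m(y) > 0, assume differentiation under the integral sign is valid at y, and assume the posterior P_y with density x ↦ p(x) q(y−x)/m(y) satisfies P_y({y}) = 0. Then ∇ log m(y) = −λ E_{X∼P_y}[(y−X)/‖y−X‖₂], and equivalently ∇ log m(y) = −λ ∇_{y′} ES(P_y, y′)|_{y′=y}, where ES is the Euclidean energy score with β = 1; i.e. the score of the Laplace-noised marginal equals −λ times the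 path gradient of the ordinary energy score at the posterior. -/
open MeasureTheory

noncomputable section

/-- The (negative) Euclidean energy score with `β = 1`:
`ES(P,y) = E_{X∼P}[‖X-y‖₂] - ½ E_{X,X'∼P}[‖X-X'‖₂]`. -/
def euclES {n : ℕ} (P : Measure (EuclideanSpace ℝ (Fin n)))
    (y : EuclideanSpace ℝ (Fin n)) : ℝ :=
  (∫ x, ‖x - y‖ ∂P) - (1 / 2) * ∫ x, ∫ x', ‖x - x'‖ ∂P ∂P

theorem hasGradientAt_norm {E : Type*} [NormedAddCommGroup E] [InnerProductSpace ℝ E]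
    [CompleteSpace E] {u : E} (hu : u ≠ 0) :
    HasGradientAt (fun v : E => ‖v‖) (‖u‖⁻¹ • u) u := by
  have hn : ‖u‖ ≠ 0 := norm_ne_zero_iff.mpr hu
  have h := ((hasStrictFDerivAt_norm_sq u).hasFDerivAt).sqrt (pow_ne_zero 2 hn)
  simp only [Real.sqrt_sq (norm_nonneg _)] at h
  rw [hasGradientAt_iff_hasFDerivAt]
  refine h.congr_fderiv ?_
  ext v
  simp
  field_simp

theorem hasGradientAt_norm_const_sub {E : Type*} [NormedAddCommGroup E] [InnerProductSpace ℝ E]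
    [CompleteSpace E] {x y : E} (hxy : x ≠ y) :
    HasGradientAt (fun z : E => ‖x - z‖) (‖y - x‖⁻¹ • (y - x)) y := by
  have h := (hasGradientAt_norm (sub_ne_zero.mpr hxy.symm)).hasFDerivAt.comp y
    ((hasFDerivAt_id y).sub_const x)
  rw [hasGradientAt_iff_hasFDerivAt]
  simpa [Function.comp_def, norm_sub_rev] using h

theorem hasGradientAt_laplace_density {E : Type*} [NormedAddCommGroup E]
    [InnerProductSpace ℝ E] [CompleteSpace E] (c lam : ℝ) {u : E} (hu : u ≠ 0) :
    HasGradientAt (fun v : E => c * Real.exp (-(lam * ‖v‖)))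
      (-(lam * (c * Real.exp (-(lam * ‖u‖)))) • ‖u‖⁻¹ • u) u := by
  have h := (((hasGradientAt_norm hu).hasFDerivAt.const_mul lam).neg.exp).const_mul c
  rw [hasGradientAt_iff_hasFDerivAt]
  refine h.congr_fderiv ?_
  ext v
  simp
  ring

/-- **Score of the Laplace-noised marginal and the ordinary energy score.** For the
isotropic multivariate Laplace noise `q(u) = Z⁻¹ exp(-λ‖u‖₂)`, clean density `p`, noisy
marginal `m(y) = ∫ p(x) q(y-x) dx` positive at `y`, posterior `P_y` with density
`x ↦ p(x) q(y-x)/m(y)` having `P_y({y}) = 0`, and differentiation under the integral sign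
valid at `y`, the score of the marginal is `-λ E_{P_y}[(y-X)/‖y-X‖₂]`, which equals `-λ`
times the path gradient at `y' = y` of the Euclidean energy score (`β = 1`) at the fixed
posterior `P_y`. -/
theorem laplace_score_energy_identity
    {n : ℕ} (lam : ℝ) (hlam : 0 < lam) (Z : ℝ) (hZ : 0 < Z)
    (q : EuclideanSpace ℝ (Fin n) → ℝ)
    (hq : ∀ u, q u = Z⁻¹ * Real.exp (-(lam * ‖u‖)))
    (hq_int : ∫ u, q u = 1)
    (p : EuclideanSpace ℝ (Fin n) → ℝ)
    (hp_nonneg : ∀ x, 0 ≤ p x) (hp_int : ∫ x, p x = 1)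
    (m : EuclideanSpace ℝ (Fin n) → ℝ)
    (hm : ∀ z, m z = ∫ x, p x * q (z - x))
    (y : EuclideanSpace ℝ (Fin n)) (hmy : 0 < m y)
    (Py : Measure (EuclideanSpace ℝ (Fin n)))
    (hPy : Py = volume.withDensity fun x => ENNReal.ofReal (p x * q (y - x) / m y))
    (hDUI : HasGradientAt m (∫ x, p x • gradient q (y - x)) y)
    (hDUI_ES : HasGradientAt (fun y' => ∫ x, ‖x - y'‖ ∂Py)
        (∫ x, gradient (fun y' => ‖x - y'‖) y ∂Py) y)
    (hpt : Py {y} = 0) :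
    gradient (fun z => Real.log (m z)) y = (-lam) • ∫ x, ‖y - x‖⁻¹ • (y - x) ∂Py
    ∧ gradient (fun z => Real.log (m z)) y
        = (-lam) • gradient (fun y' => euclES Py y') y := by
  rcases Nat.eq_zero_or_pos n with rfl | hn
  · exact ⟨Subsingleton.elim _ _, Subsingleton.elim _ _⟩
  have : Nonempty (Fin n) := ⟨⟨0, hn⟩⟩
  have hp : Integrable p := by
    by_contra h
    simp [integral_undef h] at hp_int
  have hq_cont : Continuous q := by
    rw [funext hq]
    fun_prop
  have hq_nonneg : ∀ u, 0 ≤ q u := fun u => by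
    rw [hq]
    positivity
  have hdens : AEMeasurable (fun x => ENNReal.ofReal (p x * q (y - x) / m y)) :=
    ((hp.aemeasurable.mul (hq_cont.comp (continuous_const.sub continuous_id)).aemeasurable
      ).div_const _).ennreal_ofReal
  have hgrad_q : ∀ x, x ≠ y →
      gradient q (y - x) = -(lam * q (y - x)) • ‖y - x‖⁻¹ • (y - x) := fun x hx => by
    rw [hq (y - x), funext hq]
    exact (hasGradientAt_laplace_density Z⁻¹ lam (sub_ne_zero.mpr hx.symm)).gradient
  have hpost : ∫ x, ‖y - x‖⁻¹ • (y - x) ∂Py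
      = ∫ x, (p x * q (y - x) / m y) • ‖y - x‖⁻¹ • (y - x) := by
    rw [hPy, integral_withDensity_eq_integral_toReal_smul₀ hdens
      (ae_of_all _ fun _ => ENNReal.ofReal_lt_top)]
    congr 1 with x : 1
    rw [ENNReal.toReal_ofReal
      (div_nonneg (mul_nonneg (hp_nonneg x) (hq_nonneg _)) hmy.le)]
  have hlog : gradient (fun z => Real.log (m z)) y
      = (m y)⁻¹ • ∫ x, p x • gradient q (y - x) := by
    refine HasGradientAt.gradient ?_
    rw [hasGradientAt_iff_hasFDerivAt]
    simpa using hDUI.hasFDerivAt.log hmy.ne'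
  have hscore : gradient (fun z => Real.log (m z)) y
      = (-lam) • ∫ x, ‖y - x‖⁻¹ • (y - x) ∂Py := by
    rw [hlog, hpost, ← integral_smul, ← integral_smul]
    refine integral_congr_ae ?_
    filter_upwards [Measure.ae_ne volume y] with x hx
    rw [hgrad_q x hx]
    simp only [smul_smul]
    congr 1
    ring
  have hES : gradient (fun y' => euclES Py y') y = ∫ x, ‖y - x‖⁻¹ • (y - x) ∂Py := by
    have hpath : ∫ x, gradient (fun y' => ‖x - y'‖) y ∂Py
        = ∫ x, ‖y - x‖⁻¹ • (y - x) ∂Py := by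
      refine integral_congr_ae ?_
      filter_upwards [measure_eq_zero_iff_ae_notMem.mp hpt] with x hx
      exact (hasGradientAt_norm_const_sub hx).gradient
    rw [← hpath]
    refine HasGradientAt.gradient ?_
    rw [hasGradientAt_iff_hasFDerivAt]
    exact hDUI_ES.hasFDerivAt.sub_const _
  exact ⟨hscore, by rw [hES, hscore]⟩
end
end

section
/- Let β ∈ (0, 2], Σ a symmetric positive definite n×n matrix, and let P and Q be Borel probability measures on ℝⁿ with ∫ ‖x‖₂^β dP(x) < ∞ and ∫ ‖x‖₂^β dQ(x) < ∞. Then the Mahalanobis energy score is a proper scoring rule: E_{y∼Q}[ES_{Σ⁻¹,β}(P, y)] ≥ E_{y∼Q}[ES_{Σ⁻¹,β}(Q, y)]. -/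
open MeasureTheory Matrix

noncomputable section

/-- The (negative) Mahalanobis energy score
`ES_{S,β}(P,y) = E_{X∼P}[‖X-y‖_S^β] - ½ E_{X,X'∼P}[‖X-X'‖_S^β]`. -/
def ES {n : ℕ} (S : Matrix (Fin n) (Fin n) ℝ) (β : ℝ)
    (P : Measure (EuclideanSpace ℝ (Fin n))) (y : EuclideanSpace ℝ (Fin n)) : ℝ :=
  (∫ x, mahNorm S (x - y) ^ β ∂P) - (1 / 2) * ∫ x, ∫ x', mahNorm S (x - x') ^ β ∂P ∂P

open scoped ENNReal RealInnerProductSpace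

/-- The energy inequality `E k(X,X') + E k(Y,Y') ≤ 2 E k(Y,X)` for independent
`X, X' ∼ P` and `Y, Y' ∼ Q`. -/
def EnergyIneq {E : Type*} [MeasurableSpace E] (P Q : Measure E) (k : E × E → ℝ≥0∞) : Prop :=
  ∫⁻ z, k z ∂(P.prod P) + ∫⁻ z, k z ∂(Q.prod Q) ≤ 2 * ∫⁻ z, k z ∂(Q.prod P)

namespace EnergyIneq

variable {E : Type*} [MeasurableSpace E] {P Q : Measure E}

theorem add {k l : E × E → ℝ≥0∞} (hk : EnergyIneq P Q k) (hl : EnergyIneq P Q l)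
    (hkm : Measurable k) : EnergyIneq P Q (fun z => k z + l z) := by
  unfold EnergyIneq at *
  simp only [lintegral_add_left hkm, mul_add]
  calc _ = (∫⁻ z, k z ∂(P.prod P) + ∫⁻ z, k z ∂(Q.prod Q)) +
        (∫⁻ z, l z ∂(P.prod P) + ∫⁻ z, l z ∂(Q.prod Q)) := by ring
    _ ≤ _ := add_le_add hk hl

theorem mul_const {k : E × E → ℝ≥0∞} (hk : EnergyIneq P Q k) (hkm : Measurable k) (c : ℝ≥0∞) :
    EnergyIneq P Q (fun z => k z * c) := by
  unfold EnergyIneq at *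
  simp only [lintegral_mul_const _ hkm, ← add_mul, ← mul_assoc]
  gcongr

theorem of_mul_const {k : E × E → ℝ≥0∞} {c : ℝ≥0∞} (hc : c ≠ 0) (hc' : c ≠ ∞)
    (hkm : Measurable k) (hk : EnergyIneq P Q (fun z => k z * c)) : EnergyIneq P Q k := by
  have h := hk.mul_const (hkm.mul_const c) c⁻¹
  simpa only [mul_assoc, ENNReal.mul_inv_cancel hc hc', mul_one] using h

theorem lintegral [SFinite P] [SFinite Q] {Ω : Type*} [MeasurableSpace Ω] (μ : Measure Ω)
    [SFinite μ] {k : Ω → E × E → ℝ≥0∞} (hkm : Measurable (Function.uncurry k))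
    (hk : ∀ ω, EnergyIneq P Q (k ω)) : EnergyIneq P Q (fun z => ∫⁻ ω, k ω z ∂μ) := by
  have swap (ν : Measure (E × E)) [SFinite ν] :
      ∫⁻ z, ∫⁻ ω, k ω z ∂μ ∂ν = ∫⁻ ω, ∫⁻ z, k ω z ∂ν ∂μ :=
    (lintegral_lintegral_swap hkm.aemeasurable).symm
  have hm (ν : Measure (E × E)) [SFinite ν] : Measurable (fun ω => ∫⁻ z, k ω z ∂ν) :=
    hkm.lintegral_prod_right'
  unfold EnergyIneq at *
  rw [swap, swap, swap, ← lintegral_add_left (hm _), ← lintegral_const_mul _ (hm _)]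
  exact lintegral_mono hk

theorem sq_sub [IsProbabilityMeasure P] [IsProbabilityMeasure Q] {f : E → ℝ}
    (hP : MemLp f 2 P) (hQ : MemLp f 2 Q) :
    EnergyIneq P Q (fun z => ENNReal.ofReal ((f z.1 - f z.2) ^ 2)) := by
  have key (μ ν : Measure E) [IsProbabilityMeasure μ] [IsProbabilityMeasure ν]
      (hμ : MemLp f 2 μ) (hν : MemLp f 2 ν) :
      ∫⁻ z, ENNReal.ofReal ((f z.1 - f z.2) ^ 2) ∂(μ.prod ν) =
        ENNReal.ofReal ((∫ x, f x ^ 2 ∂μ) + (∫ x, f x ^ 2 ∂ν) -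
          2 * ((∫ x, f x ∂μ) * ∫ x, f x ∂ν)) := by
    have h1 := hμ.integrable_sq.comp_fst ν
    have h2 := hν.integrable_sq.comp_snd μ
    have h12 : Integrable (fun z : E × E => f z.1 ^ 2 + f z.2 ^ 2) (μ.prod ν) := h1.add h2
    have h3 := ((hμ.integrable one_le_two).mul_prod (hν.integrable one_le_two)).const_mul 2
    have e (z : E × E) :
        (f z.1 - f z.2) ^ 2 = f z.1 ^ 2 + f z.2 ^ 2 - 2 * (f z.1 * f z.2) := by ring
    have hint : Integrable (fun z : E × E => (f z.1 - f z.2) ^ 2) (μ.prod ν) := by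
      simp only [e]
      exact h12.sub h3
    rw [← ofReal_integral_eq_lintegral_ofReal hint (Filter.Eventually.of_forall
      fun z => sq_nonneg _)]
    simp only [e]
    rw [integral_sub h12 h3, integral_add h1 h2, integral_const_mul, integral_prod_mul,
      integral_fun_fst (fun x => f x ^ 2), integral_fun_snd (fun x => f x ^ 2)]
    simp
  have nonneg (μ : Measure E) [IsProbabilityMeasure μ] (hμ : MemLp f 2 μ) :
      0 ≤ (∫ x, f x ^ 2 ∂μ) + (∫ x, f x ^ 2 ∂μ) - 2 * ((∫ x, f x ∂μ) * ∫ x, f x ∂μ) := by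
    have := ProbabilityTheory.variance_nonneg f μ
    rw [ProbabilityTheory.variance_eq_sub hμ] at this
    simp only [Pi.pow_apply] at this
    linarith
  unfold EnergyIneq
  rw [key P P hP hP, key Q Q hQ hQ, key Q P hQ hP, ← ENNReal.ofReal_add (nonneg P hP) (nonneg Q hQ),
    ← ENNReal.ofReal_ofNat 2, ← ENNReal.ofReal_mul zero_le_two]
  apply ENNReal.ofReal_le_ofReal
  linarith [sq_nonneg ((∫ x, f x ∂P) - ∫ x, f x ∂Q)]

theorem one_sub_cos [IsProbabilityMeasure P] [IsProbabilityMeasure Q] {f : E → ℝ}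
    (hf : Measurable f) :
    EnergyIneq P Q (fun z => ENNReal.ofReal (1 - Real.cos (f z.1 - f z.2))) := by
  have hc (μ : Measure E) [IsProbabilityMeasure μ] : MemLp (fun x => Real.cos (f x)) 2 μ :=
    MemLp.of_bound (by fun_prop) 1 (Filter.Eventually.of_forall fun x => Real.abs_cos_le_one _)
  have hs (μ : Measure E) [IsProbabilityMeasure μ] : MemLp (fun x => Real.sin (f x)) 2 μ :=
    MemLp.of_bound (by fun_prop) 1 (Filter.Eventually.of_forall fun x => Real.abs_sin_le_one _)
  have h := (sq_sub (hc P) (hc Q)).add (sq_sub (hs P) (hs Q)) (by fun_prop)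
  refine of_mul_const (c := 2) (by simp) (by simp) (by fun_prop) ?_
  convert h using 2 with z
  rw [← ENNReal.ofReal_add (sq_nonneg _) (sq_nonneg _), ← ENNReal.ofReal_ofNat 2,
    ← ENNReal.ofReal_mul (by linarith [Real.cos_le_one (f z.1 - f z.2)]), Real.cos_sub]
  congr 1
  linear_combination -(Real.sin_sq_add_cos_sq (f z.1)) - Real.sin_sq_add_cos_sq (f z.2)

end EnergyIneq

theorem lintegral_Ioi_comp_mul_left {g : ℝ → ℝ≥0∞} (hg : Measurable g) {a : ℝ} (ha : 0 < a) :
    ∫⁻ r in Set.Ioi 0, g (a * r) = ENNReal.ofReal a⁻¹ * ∫⁻ r in Set.Ioi 0, g r := by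
  have h := setLIntegral_map (μ := volume) (measurableSet_Ioi (a := (0 : ℝ))) hg
    (measurable_const_mul a)
  rw [Real.map_volume_mul_left ha.ne', Measure.restrict_smul, lintegral_smul_measure,
    abs_of_pos (inv_pos.2 ha)] at h
  have e : (fun x => a * x) ⁻¹' Set.Ioi 0 = Set.Ioi (0 : ℝ) := by
    ext x; simp [ha]
  rw [e] at h
  exact h.symm

/-- The Lévy–Khintchine integral representing `|a| ^ β` up to a constant factor. -/
def levyIntegral (β a : ℝ) : ℝ≥0∞ :=
  ∫⁻ r in Set.Ioi 0, ENNReal.ofReal (1 - Real.cos (a * r)) * ENNReal.ofReal (r ^ (-1 - β))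

theorem levyIntegral_eq {β : ℝ} (hβ : 0 < β) (a : ℝ) :
    levyIntegral β a = ENNReal.ofReal (|a| ^ β) * levyIntegral β 1 := by
  wlog ha : 0 < a generalizing a
  · rcases (not_lt.1 ha).eq_or_lt with rfl | h
    · simp [levyIntegral, Real.zero_rpow hβ.ne']
    · rw [← abs_neg, ← this (-a) (neg_pos.2 h)]
      simp [levyIntegral]
  have h := lintegral_Ioi_comp_mul_left (g := fun r => ENNReal.ofReal (1 - Real.cos (1 * r)) *
    ENNReal.ofReal (r ^ (-1 - β))) (by fun_prop) ha
  have e : levyIntegral β a = ENNReal.ofReal (a ^ (1 + β)) *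
      ∫⁻ r in Set.Ioi 0, ENNReal.ofReal (1 - Real.cos (1 * (a * r))) *
        ENNReal.ofReal ((a * r) ^ (-1 - β)) := by
    rw [levyIntegral, ← lintegral_const_mul _ (by fun_prop)]
    refine setLIntegral_congr_fun measurableSet_Ioi fun r hr => ?_
    have hr : 0 < r := hr
    have : r ^ (-1 - β) = a ^ (1 + β) * (a * r) ^ (-1 - β) := by
      rw [Real.mul_rpow ha.le hr.le, ← mul_assoc, ← Real.rpow_add ha]
      simp
    simp only [one_mul]
    rw [this, ENNReal.ofReal_mul (by positivity)]
    ring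
  rw [e, h, ← mul_assoc, ← ENNReal.ofReal_mul (by positivity), abs_of_pos ha, levyIntegral]
  congr 2
  rw [Real.rpow_add ha, Real.rpow_one]
  field_simp

theorem levyIntegral_one_ne_zero (β : ℝ) : levyIntegral β 1 ≠ 0 := by
  rw [← pos_iff_ne_zero, levyIntegral, setLIntegral_pos_iff (by fun_prop)]
  refine lt_of_lt_of_le (b := volume (Set.Ioo (0 : ℝ) 1)) (by simp) (measure_mono fun r hr => ?_)
  have hr0 : 0 < r := hr.1
  refine ⟨?_, hr0⟩
  have hcos : Real.cos r < 1 := by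
    rw [← Real.cos_zero]
    exact Real.cos_lt_cos_of_nonneg_of_le_pi le_rfl
      (by linarith [hr.2, Real.pi_gt_three]) hr0
  have : 0 < r ^ (-1 - β) := by positivity
  simp [hcos, this]

theorem levyIntegral_one_ne_top {β : ℝ} (hβ : 0 < β) (hβ2 : β < 2) : levyIntegral β 1 ≠ ∞ := by
  have hint : IntegrableOn (fun r : ℝ => (1 - Real.cos r) * r ^ (-1 - β)) (Set.Ioi 0) := by
    have hmeas : Measurable (fun r : ℝ => (1 - Real.cos r) * r ^ (-1 - β)) := by fun_prop
    rw [← Set.Ioc_union_Ioi_eq_Ioi zero_le_one]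
    refine IntegrableOn.union ?_ ?_
    · have h : IntegrableOn (fun r : ℝ => r ^ (1 - β)) (Set.Ioc 0 1) :=
        (integrableOn_Ioc_iff_integrableOn_Ioo (by simp)).2
          ((intervalIntegral.integrableOn_Ioo_rpow_iff one_pos).2 (by linarith))
      refine Integrable.mono' h hmeas.aestronglyMeasurable ?_
      filter_upwards [ae_restrict_mem measurableSet_Ioc] with r hr
      have hr0 : 0 < r := hr.1
      have hc := Real.cos_le_one r
      rw [Real.norm_of_nonneg (mul_nonneg (by linarith) (by positivity))]
      have e : r ^ (1 - β) = r ^ 2 * r ^ (-1 - β) := by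
        rw [← Real.rpow_natCast, ← Real.rpow_add hr0]
        congr 1
        push_cast
        ring
      rw [e]
      gcongr
      nlinarith [Real.one_sub_sq_div_two_le_cos (x := r)]
    · have h := (integrableOn_Ioi_rpow_of_lt (a := -1 - β) (by linarith) one_pos).const_mul 2
      refine Integrable.mono' h hmeas.aestronglyMeasurable ?_
      filter_upwards [ae_restrict_mem measurableSet_Ioi] with r hr
      have hr0 : 0 < r := one_pos.trans hr
      have hc := Real.cos_le_one r
      rw [Real.norm_of_nonneg (mul_nonneg (by linarith) (by positivity))]
      gcongr
      linarith [Real.neg_one_le_cos r]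
  have h := hint.lintegral_lt_top.ne
  simpa only [levyIntegral, one_mul,
    ENNReal.ofReal_mul (sub_nonneg.2 (Real.cos_le_one _))] using h

theorem EnergyIneq.abs_sub_rpow {E : Type*} [MeasurableSpace E] {P Q : Measure E}
    [IsProbabilityMeasure P] [IsProbabilityMeasure Q] {β : ℝ} (hβ : 0 < β) (hβ2 : β < 2)
    {f : E → ℝ} (hf : Measurable f) :
    EnergyIneq P Q (fun z => ENNReal.ofReal (|f z.1 - f z.2| ^ β)) := by
  refine of_mul_const (levyIntegral_one_ne_zero β) (levyIntegral_one_ne_top hβ hβ2)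
    (by fun_prop) ?_
  simp only [← levyIntegral_eq hβ]
  simp only [levyIntegral]
  refine EnergyIneq.lintegral
    (k := fun (r : ℝ) (z : E × E) => ENNReal.ofReal (1 - Real.cos ((f z.1 - f z.2) * r)) *
      ENNReal.ofReal (r ^ (-1 - β))) _ (by unfold Function.uncurry; fun_prop) fun r => ?_
  refine mul_const ?_ (by fun_prop) _
  simp only [sub_mul]
  exact one_sub_cos (f := fun x => f x * r) (hf.mul_const r)

section Ball

variable {V : Type*} [NormedAddCommGroup V] [InnerProductSpace ℝ V] [FiniteDimensional ℝ V]
  [MeasurableSpace V] [BorelSpace V]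

/-- The integral of `|⟪t, v⟫| ^ β` over `t` in the unit ball. -/
def ballMoment (β : ℝ) (v : V) : ℝ≥0∞ :=
  ∫⁻ t in Metric.ball (0 : V) 1, ENNReal.ofReal (|⟪t, v⟫| ^ β)

theorem ballMoment_smul (β c : ℝ) (v : V) :
    ballMoment β (c • v) = ENNReal.ofReal (|c| ^ β) * ballMoment β v := by
  rw [ballMoment, ballMoment, ← lintegral_const_mul _ (by fun_prop)]
  refine lintegral_congr fun t => ?_
  rw [inner_smul_right, abs_mul, Real.mul_rpow (abs_nonneg _) (abs_nonneg _),
    ENNReal.ofReal_mul (by positivity)]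

theorem ballMoment_eq_of_norm_eq (β : ℝ) {v w : V} (h : ‖v‖ = ‖w‖) :
    ballMoment β v = ballMoment β w := by
  have hr := Submodule.reflection_sub h
  set R := (Submodule.span ℝ {v - w})ᗮ.reflection
  have hp := R.measurePreserving.setLIntegral_comp_preimage_emb
    R.toHomeomorph.measurableEmbedding
    (fun t => ENNReal.ofReal (|⟪t, w⟫| ^ β)) (Metric.ball 0 1)
  have hb : R ⁻¹' Metric.ball 0 1 = Metric.ball 0 1 := by
    ext t; simp
  rw [hb] at hp
  rw [ballMoment, ballMoment, ← hp]
  refine lintegral_congr fun t => ?_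
  rw [← hr, R.inner_map_map]

theorem ballMoment_ne_top {β : ℝ} (hβ : 0 < β) (v : V) : ballMoment β v ≠ ∞ := by
  refine (setLIntegral_lt_top_of_le_nnreal measure_ball_lt_top.ne
    ⟨(‖v‖ ^ β).toNNReal, fun t ht => ?_⟩).ne
  refine ENNReal.ofReal_le_ofReal ?_
  gcongr
  have ht : ‖t‖ < 1 := by simpa using ht
  exact (abs_real_inner_le_norm t v).trans (mul_le_of_le_one_left (norm_nonneg _) ht.le)

theorem ballMoment_ne_zero (β : ℝ) {v : V} (hv : v ≠ 0) : ballMoment β v ≠ 0 := by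
  rw [← pos_iff_ne_zero, ballMoment, setLIntegral_pos_iff (by fun_prop)]
  let U : Set V := {t | 0 < ⟪t, v⟫} ∩ Metric.ball 0 1
  have hU : IsOpen U := (isOpen_lt (by fun_prop) (by fun_prop)).inter Metric.isOpen_ball
  have hv' : 0 < ‖v‖ := norm_pos_iff.2 hv
  have hne : U.Nonempty := by
    refine ⟨(2 * ‖v‖)⁻¹ • v, ?_, ?_⟩
    · simp only [Set.mem_ofPred_eq, inner_smul_left, real_inner_self_eq_norm_sq]
      simp only [conj_trivial]
      positivity
    · rw [mem_ball_zero_iff, norm_smul, Real.norm_of_nonneg (by positivity)]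
      field_simp
      norm_num
  refine (hU.measure_pos volume hne).trans_le (measure_mono fun t ht => ⟨?_, ht.2⟩)
  have ht : 0 < ⟪t, v⟫ := ht.1
  have : 0 < |⟪t, v⟫| ^ β := Real.rpow_pos_of_pos (abs_pos.2 ht.ne') β
  simpa using this

theorem exists_ballMoment_eq {β : ℝ} (hβ : 0 < β) : ∃ c : ℝ≥0∞, c ≠ 0 ∧ c ≠ ∞ ∧
    ∀ v : V, ballMoment β v = ENNReal.ofReal (‖v‖ ^ β) * c := by
  have zero : ballMoment β (0 : V) = 0 := by simp [ballMoment, Real.zero_rpow hβ.ne']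
  rcases subsingleton_or_nontrivial V with hV | hV
  · refine ⟨1, one_ne_zero, ENNReal.one_ne_top, fun v => ?_⟩
    simp [Subsingleton.elim v 0, zero, Real.zero_rpow hβ.ne']
  · obtain ⟨e, he⟩ := exists_norm_eq V zero_le_one
    have he0 : e ≠ 0 := by rintro rfl; simp at he
    refine ⟨ballMoment β e, ballMoment_ne_zero β he0, ballMoment_ne_top hβ e, fun v => ?_⟩
    rw [ballMoment_eq_of_norm_eq β (w := ‖v‖ • e) (by simp [norm_smul, he]), ballMoment_smul,
      abs_norm]

theorem EnergyIneq.norm_sub_rpow {E : Type*} [MeasurableSpace E] {P Q : Measure E}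
    [IsProbabilityMeasure P] [IsProbabilityMeasure Q] {β : ℝ} (hβ : 0 < β) (hβ2 : β ≤ 2)
    {f : E → V} (hf : Measurable f) (hP : Integrable (fun x => ‖f x‖ ^ β) P)
    (hQ : Integrable (fun x => ‖f x‖ ^ β) Q) :
    EnergyIneq P Q (fun z => ENNReal.ofReal (‖f z.1 - f z.2‖ ^ β)) := by
  obtain ⟨c, hc, hc', h⟩ := exists_ballMoment_eq (V := V) hβ
  refine of_mul_const hc hc' (by fun_prop) ?_
  simp only [← h, ballMoment]
  refine EnergyIneq.lintegral
    (k := fun (t : V) (z : E × E) => ENNReal.ofReal (|⟪t, f z.1 - f z.2⟫| ^ β)) _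
    (by unfold Function.uncurry; fun_prop) fun t => ?_
  simp only [inner_sub_right]
  rcases hβ2.lt_or_eq with hβ2 | rfl
  · exact abs_sub_rpow (f := fun x => ⟪t, f x⟫) hβ hβ2 (by fun_prop)
  · have hL (μ : Measure E) (hμ : Integrable (fun x => ‖f x‖ ^ (2 : ℝ)) μ) :
        MemLp (fun x => ⟪t, f x⟫) 2 μ := by
      refine MemLp.const_inner t ((memLp_two_iff_integrable_sq_norm hf.aestronglyMeasurable).2 ?_)
      simpa using hμ
    simpa using sq_sub (f := fun x => ⟪t, f x⟫) (hL P hP) (hL Q hQ)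

end Ball

theorem integrable_norm_sub_rpow {E V : Type*} [MeasurableSpace E] [NormedAddCommGroup V]
    [MeasurableSpace V] [BorelSpace V] [SecondCountableTopology V] {μ ν : Measure E}
    [IsFiniteMeasure μ] [IsFiniteMeasure ν] {β : ℝ} (hβ : 0 < β) {f : E → V} (hf : Measurable f)
    (hμ : Integrable (fun x => ‖f x‖ ^ β) μ) (hν : Integrable (fun x => ‖f x‖ ^ β) ν) :
    Integrable (fun z : E × E => ‖f z.1 - f z.2‖ ^ β) (μ.prod ν) := by
  refine Integrable.mono' (((hμ.comp_fst ν).add (hν.comp_snd μ)).const_mul (2 ^ β))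
    (Measurable.aestronglyMeasurable (by fun_prop)) (Filter.Eventually.of_forall fun z => ?_)
  rw [Real.norm_of_nonneg (by positivity)]
  calc ‖f z.1 - f z.2‖ ^ β ≤ (2 * max ‖f z.1‖ ‖f z.2‖) ^ β := by
        gcongr
        linarith [norm_sub_le (f z.1) (f z.2), le_max_left ‖f z.1‖ ‖f z.2‖,
          le_max_right ‖f z.1‖ ‖f z.2‖]
    _ = 2 ^ β * max ‖f z.1‖ ‖f z.2‖ ^ β := Real.mul_rpow (by positivity) (by positivity)
    _ ≤ 2 ^ β * (‖f z.1‖ ^ β + ‖f z.2‖ ^ β) := by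
        gcongr
        have h1 : 0 ≤ ‖f z.1‖ ^ β := by positivity
        have h2 : 0 ≤ ‖f z.2‖ ^ β := by positivity
        rcases max_choice ‖f z.1‖ ‖f z.2‖ with h | h <;> rw [h] <;> linarith

open scoped MatrixOrder Matrix.Norms.L2Operator in
theorem exists_mahNorm_eq {n : ℕ} {S : Matrix (Fin n) (Fin n) ℝ} (hS : S.PosSemidef) :
    ∃ A : EuclideanSpace ℝ (Fin n) →L[ℝ] EuclideanSpace ℝ (Fin n),
      ∀ u, mahNorm S u = ‖A u‖ := by
  obtain ⟨B, rfl⟩ := CStarAlgebra.nonneg_iff_eq_star_mul_self.1 hS.nonneg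
  refine ⟨Matrix.toEuclideanCLM (𝕜 := ℝ) B, fun u => ?_⟩
  rw [mahNorm, EuclideanSpace.norm_eq]
  congr 1
  have : (star B * B).mulVec u = Bᵀ.mulVec (B.mulVec u) := by
    rw [Matrix.mulVec_mulVec]; rfl
  rw [this, Matrix.dotProduct_mulVec, Matrix.vecMul_transpose]
  simp [dotProduct, sq]

/-- **Propriety of the Mahalanobis energy score.** For `β ∈ (0,2]`, a symmetric positive
definite `Σ`, and Borel probability measures `P, Q` on ℝⁿ with finite `β`-th moments, the
expected (negative) energy score under `Q` is minimized by `Q`: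
`E_{y∼Q}[ES_{Σ⁻¹,β}(Q,y)] ≤ E_{y∼Q}[ES_{Σ⁻¹,β}(P,y)]`. -/
theorem mahalanobis_energy_score_proper
    {n : ℕ} (β : ℝ) (hβ : 0 < β) (hβ2 : β ≤ 2)
    (Sig : Matrix (Fin n) (Fin n) ℝ) (hSig : Sig.PosDef)
    (P Q : Measure (EuclideanSpace ℝ (Fin n)))
    [IsProbabilityMeasure P] [IsProbabilityMeasure Q]
    (hP : Integrable (fun x => ‖x‖ ^ β) P)
    (hQ : Integrable (fun x => ‖x‖ ^ β) Q) :
    (∫ y, ES Sig⁻¹ β Q y ∂Q) ≤ ∫ y, ES Sig⁻¹ β P y ∂Q := by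
  obtain ⟨A, hA⟩ := exists_mahNorm_eq hSig.inv.posSemidef
  have hAm : Measurable A := A.continuous.measurable
  have hAint (μ : Measure (EuclideanSpace ℝ (Fin n))) (hμ : Integrable (fun x => ‖x‖ ^ β) μ) :
      Integrable (fun x => ‖A x‖ ^ β) μ := by
    refine Integrable.mono' (hμ.const_mul (‖A‖ ^ β))
      (Measurable.aestronglyMeasurable (by fun_prop)) (Filter.Eventually.of_forall fun x => ?_)
    rw [Real.norm_of_nonneg (by positivity), ← Real.mul_rpow (norm_nonneg _) (norm_nonneg _)]
    gcongr
    exact A.le_opNorm x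
  have hAP := hAint P hP
  have hAQ := hAint Q hQ
  have iPP := integrable_norm_sub_rpow hβ hAm hAP hAP
  have iQQ := integrable_norm_sub_rpow hβ hAm hAQ hAQ
  have iQP := integrable_norm_sub_rpow hβ hAm hAQ hAP
  have score (μ : Measure (EuclideanSpace ℝ (Fin n))) [IsProbabilityMeasure μ]
      (hμ : Integrable (fun x => ‖A x‖ ^ β) μ) :
      ∫ y, ES Sig⁻¹ β μ y ∂Q = ∫ z, ‖A z.1 - A z.2‖ ^ β ∂(Q.prod μ) -
        1 / 2 * ∫ z, ‖A z.1 - A z.2‖ ^ β ∂(μ.prod μ) := by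
    have i1 := integrable_norm_sub_rpow hβ hAm hAQ hμ
    have i2 := integrable_norm_sub_rpow hβ hAm hμ hμ
    rw [integral_prod _ i1, integral_prod _ i2]
    simp only [ES, hA, map_sub]
    rw [integral_sub (by simpa only [norm_sub_rev] using i1.integral_prod_left)
      (integrable_const _), integral_const, probReal_univ, one_smul]
    simp only [norm_sub_rev]
  have h := EnergyIneq.norm_sub_rpow hβ hβ2 hAm hAP hAQ
  unfold EnergyIneq at h
  have nn (z : EuclideanSpace ℝ (Fin n) × EuclideanSpace ℝ (Fin n)) :
    0 ≤ ‖A z.1 - A z.2‖ ^ β := by positivity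
  rw [← ofReal_integral_eq_lintegral_ofReal iPP (.of_forall nn),
    ← ofReal_integral_eq_lintegral_ofReal iQQ (.of_forall nn),
    ← ofReal_integral_eq_lintegral_ofReal iQP (.of_forall nn),
    ← ENNReal.ofReal_add (integral_nonneg nn) (integral_nonneg nn),
    two_mul, ← ENNReal.ofReal_add (integral_nonneg nn) (integral_nonneg nn),
    ENNReal.ofReal_le_ofReal_iff (add_nonneg (integral_nonneg nn) (integral_nonneg nn))] at h
  rw [score P hAP, score Q hAQ]
  linarith
end
end

section
/- Let β ∈ (0, 2) (strictly less than 2), Σ a symmetric positive definite n×n matrix, and let P and Q be Borel probability measures on ℝⁿ with ∫ ‖x‖₂^β dP(x) < ∞ and ∫ ‖x‖₂^β dQ(x) < ∞. If E_{y∼Q}[ES_{Σ⁻¹,β}(P, y)] = E_{y∼Q}[ES_{Σ⁻¹,β}(Q, y)], then P = Q; i.e. the Mahalanobis energy score with β ∈ (0,2) is strictly proper. -/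
open MeasureTheory Matrix

noncomputable section

/-- The weight `‖ξ‖ ^ (-(d + β))` on a `d`-dimensional space. -/
def fourierWeight (E : Type*) [NormedAddCommGroup E] [Module ℝ E] (β : ℝ) (ξ : E) :
    ℝ :=
  ‖ξ‖ ^ (-((Module.finrank ℝ E : ℝ) + β))

lemma fourierWeight_nonneg {E : Type*} [NormedAddCommGroup E] [Module ℝ E] {β : ℝ} (ξ : E) :
    0 ≤ fourierWeight E β ξ :=
  Real.rpow_nonneg (norm_nonneg ξ) _

lemma measurable_fourierWeight {E : Type*} [NormedAddCommGroup E] [Module ℝ E]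
    [MeasurableSpace E] [OpensMeasurableSpace E] {β : ℝ} : Measurable (fourierWeight E β) := by
  unfold fourierWeight; fun_prop

lemma rpow_norm_sub_le {E : Type*} [NormedAddCommGroup E] {β : ℝ} (hβ : 0 ≤ β) (x y : E) :
    ‖x - y‖ ^ β ≤ 2 ^ β * (‖x‖ ^ β + ‖y‖ ^ β) := by
  have hx := Real.rpow_nonneg (norm_nonneg x) β
  have hy := Real.rpow_nonneg (norm_nonneg y) β
  have key : ‖x - y‖ ≤ 2 * max ‖x‖ ‖y‖ := by
    linarith [norm_sub_le x y, le_max_left ‖x‖ ‖y‖, le_max_right ‖x‖ ‖y‖]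
  calc ‖x - y‖ ^ β ≤ (2 * max ‖x‖ ‖y‖) ^ β := by gcongr
    _ = 2 ^ β * (max ‖x‖ ‖y‖) ^ β := Real.mul_rpow (by norm_num) (by positivity)
    _ ≤ _ := by
      gcongr
      rcases max_cases ‖x‖ ‖y‖ with h | h <;> rw [h.1] <;> linarith

section EnergyDistance

variable {E : Type*} [NormedAddCommGroup E] [InnerProductSpace ℝ E] [FiniteDimensional ℝ E]
  [MeasurableSpace E] [BorelSpace E] {β : ℝ}

lemma integrable_rpow_norm_sub_prod (hβ : 0 ≤ β) (P Q : Measure E) [IsFiniteMeasure P]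
    [IsFiniteMeasure Q] (hP : Integrable (fun x => ‖x‖ ^ β) P)
    (hQ : Integrable (fun x => ‖x‖ ^ β) Q) :
    Integrable (fun z : E × E => ‖z.1 - z.2‖ ^ β) (P.prod Q) := by
  refine (((hP.comp_fst Q).add (hQ.comp_snd P)).const_mul (2 ^ β)).mono'
    (by fun_prop) (.of_forall fun z => ?_)
  rw [Real.norm_of_nonneg (by positivity)]
  exact rpow_norm_sub_le hβ z.1 z.2

lemma integrable_one_sub_cos_inner_mul_fourierWeight [Nontrivial E] (hβ : 0 < β) (hβ2 : β < 2)
    (x : E) :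
    Integrable (fun ξ : E => (1 - Real.cos (inner ℝ x ξ)) * fourierWeight E β ξ) := by
  set d := Module.finrank ℝ E with hd
  have hd1 : 1 ≤ d := Module.finrank_pos
  let g : ℝ → ℝ := fun r => (if r < 1 then ‖x‖ ^ 2 * r ^ 2 else 2) * r ^ (-((d : ℝ) + β))
  have hpow (r : ℝ) (hr : 0 < r) (k : ℕ) :
      r ^ (d - 1) * (r ^ k * r ^ (-((d : ℝ) + β))) = r ^ ((k : ℝ) - 1 - β) := by
    rw [← Real.rpow_natCast, ← Real.rpow_natCast, ← Real.rpow_add hr, ← Real.rpow_add hr,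
      Nat.cast_sub hd1]
    congr 1
    push_cast
    ring
  have hg : Integrable (fun ξ : E => g ‖ξ‖) := by
    rw [integrable_fun_norm_addHaar, ← Set.Ioo_union_Ici_eq_Ioi one_pos, integrableOn_union]
    constructor
    · refine IntegrableOn.congr_fun (((intervalIntegral.integrableOn_Ioo_rpow_iff (s := 1 - β)
        one_pos).2 (by linarith)).const_mul (‖x‖ ^ 2)) (fun r hr => ?_) measurableSet_Ioo
      simp only [g, smul_eq_mul, ← hd, if_pos hr.2]
      have := hpow r hr.1 2
      rw [show ((2 : ℕ) : ℝ) - 1 - β = 1 - β by push_cast; ring] at this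
      rw [← this]
      ring
    · rw [integrableOn_Ici_iff_integrableOn_Ioi]
      refine IntegrableOn.congr_fun (((integrableOn_Ioi_rpow_iff (s := -1 - β) one_pos).2
        (by linarith)).const_mul 2) (fun r hr => ?_) measurableSet_Ioi
      have hr' : 1 < r := hr
      simp only [g, smul_eq_mul, ← hd, if_neg hr'.not_gt]
      have := hpow r (by linarith) 0
      rw [Nat.cast_zero, zero_sub, pow_zero, one_mul] at this
      rw [← this]
      ring
  refine hg.mono' (by have := measurable_fourierWeight (E := E) (β := β); fun_prop)
    (.of_forall fun ξ => ?_)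
  have h1 : 0 ≤ 1 - Real.cos (inner ℝ x ξ) := sub_nonneg.2 (Real.cos_le_one _)
  rw [Real.norm_of_nonneg (mul_nonneg h1 (fourierWeight_nonneg ξ))]
  refine mul_le_mul_of_nonneg_right ?_ (fourierWeight_nonneg ξ)
  split_ifs
  · have h2 := Real.one_sub_sq_div_two_le_cos (x := inner ℝ x ξ)
    have h3 : (inner ℝ x ξ) ^ 2 ≤ (‖x‖ * ‖ξ‖) ^ 2 := sq_le_sq' (by
      linarith [neg_abs_le (inner ℝ x ξ), abs_real_inner_le_norm x ξ]) (real_inner_le_norm x ξ)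
    nlinarith [sq_nonneg (‖x‖ * ‖ξ‖)]
  · linarith [Real.neg_one_le_cos (inner ℝ x ξ)]

lemma integral_one_sub_cos_inner_mul_fourierWeight_of_norm_eq {x y : E} (h : ‖x‖ = ‖y‖) :
    ∫ ξ : E, (1 - Real.cos (inner ℝ x ξ)) * fourierWeight E β ξ =
      ∫ ξ : E, (1 - Real.cos (inner ℝ y ξ)) * fourierWeight E β ξ := by
  let T := (ℝ ∙ (x - y))ᗮ.reflection
  have hT : T x = y := Submodule.reflection_sub h
  rw [← T.measurePreserving.integral_comp T.toHomeomorph.measurableEmbedding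
    (fun ξ : E => (1 - Real.cos (inner ℝ y ξ)) * fourierWeight E β ξ)]
  simp only [fourierWeight, ← hT, T.inner_map_map, T.norm_map]

lemma integral_one_sub_cos_inner_smul_mul_fourierWeight {r : ℝ} (hr : 0 < r) (x : E) :
    ∫ ξ : E, (1 - Real.cos (inner ℝ (r • x) ξ)) * fourierWeight E β ξ =
      r ^ β * ∫ ξ : E, (1 - Real.cos (inner ℝ x ξ)) * fourierWeight E β ξ := by
  set d := Module.finrank ℝ E with hd
  have h1 (ξ : E) : (1 - Real.cos (inner ℝ (r • x) ξ)) * fourierWeight E β ξ =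
      r ^ ((d : ℝ) + β) * ((1 - Real.cos (inner ℝ x (r • ξ))) * fourierWeight E β (r • ξ)) := by
    have h2 : r ^ ((d : ℝ) + β) * r ^ (-((d : ℝ) + β)) = 1 := by
      rw [← Real.rpow_add hr]; simp
    rw [real_inner_smul_left, real_inner_smul_right, fourierWeight, fourierWeight, norm_smul,
      Real.norm_of_nonneg hr.le, Real.mul_rpow hr.le (norm_nonneg _), ← hd]
    linear_combination (-(1 - Real.cos (r * inner ℝ x ξ)) * ‖ξ‖ ^ (-((d : ℝ) + β))) * h2
  simp_rw [h1]
  rw [integral_const_mul, Measure.integral_comp_smul_of_nonneg volume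
    (fun ξ : E => (1 - Real.cos (inner ℝ x ξ)) * fourierWeight E β ξ) r (hR := hr.le),
    smul_eq_mul, ← mul_assoc, Real.rpow_add hr, Real.rpow_natCast]
  congr 1
  field_simp
  rfl

lemma exists_integral_one_sub_cos_inner_mul_fourierWeight [Nontrivial E] (hβ : 0 < β) :
    ∃ C : ℝ, ∀ x : E,
      ∫ ξ : E, (1 - Real.cos (inner ℝ x ξ)) * fourierWeight E β ξ = C * ‖x‖ ^ β := by
  obtain ⟨u, hu⟩ := exists_norm_eq E zero_le_one
  refine ⟨∫ ξ : E, (1 - Real.cos (inner ℝ u ξ)) * fourierWeight E β ξ, fun x => ?_⟩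
  rcases eq_or_ne x 0 with rfl | hx
  · simp [hβ.ne']
  · have hx' : 0 < ‖x‖ := norm_pos_iff.2 hx
    rw [integral_one_sub_cos_inner_mul_fourierWeight_of_norm_eq (x := x) (y := ‖x‖ • u)
      (by simp [norm_smul, hu]), integral_one_sub_cos_inner_smul_mul_fourierWeight hx', mul_comm]

lemma integral_cos_inner_sub_prod (P Q : Measure E) [IsFiniteMeasure P] [IsFiniteMeasure Q]
    (ξ : E) :
    ∫ z : E × E, Real.cos (inner ℝ (z.1 - z.2) ξ) ∂P.prod Q =
      (charFun P ξ * (starRingEnd ℂ) (charFun Q ξ)).re := by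
  rw [← charFun_neg, charFun_apply, charFun_apply, ← integral_prod_mul, ← RCLike.re_eq_complex_re,
    ← integral_re]
  · refine integral_congr_ae (.of_forall fun z => ?_)
    simp only [RCLike.re_eq_complex_re]
    rw [← Complex.exp_add, ← add_mul, ← Complex.ofReal_add, Complex.exp_ofReal_mul_I_re,
      inner_neg_right, inner_sub_left, sub_eq_add_neg]
  · refine Integrable.of_bound (C := 1) (by fun_prop) (.of_forall fun z => ?_)
    rw [norm_mul, Complex.norm_exp_ofReal_mul_I, Complex.norm_exp_ofReal_mul_I, one_mul]

lemma integral_rpow_norm_sub_prod_eq [Nontrivial E] (hβ : 0 < β) (hβ2 : β < 2) {C : ℝ}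
    (hC : ∀ x : E,
      ∫ ξ : E, (1 - Real.cos (inner ℝ x ξ)) * fourierWeight E β ξ = C * ‖x‖ ^ β)
    (P Q : Measure E) [IsProbabilityMeasure P] [IsProbabilityMeasure Q]
    (hP : Integrable (fun x => ‖x‖ ^ β) P) (hQ : Integrable (fun x => ‖x‖ ^ β) Q) :
    Integrable (fun ξ : E =>
        (1 - (charFun P ξ * (starRingEnd ℂ) (charFun Q ξ)).re) * fourierWeight E β ξ) ∧
      ∫ ξ : E, (1 - (charFun P ξ * (starRingEnd ℂ) (charFun Q ξ)).re) * fourierWeight E β ξ =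
        C * ∫ z : E × E, ‖z.1 - z.2‖ ^ β ∂P.prod Q := by
  let F : (E × E) × E → ℝ := fun p =>
    (1 - Real.cos (inner ℝ (p.1.1 - p.1.2) p.2)) * fourierWeight E β p.2
  have hF0 (p) : 0 ≤ F p :=
    mul_nonneg (sub_nonneg.2 (Real.cos_le_one _)) (fourierWeight_nonneg _)
  have hFm : AEStronglyMeasurable F ((P.prod Q).prod volume) := by
    have := measurable_fourierWeight (E := E) (β := β)
    fun_prop
  have hF : Integrable F ((P.prod Q).prod volume) := by
    rw [integrable_prod_iff hFm]
    refine ⟨.of_forall fun z =>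
      integrable_one_sub_cos_inner_mul_fourierWeight hβ hβ2 (z.1 - z.2), ?_⟩
    simp_rw [Real.norm_of_nonneg (hF0 _), F, hC]
    exact (integrable_rpow_norm_sub_prod hβ.le P Q hP hQ).const_mul C
  have hinner (ξ : E) : ∫ z, F (z, ξ) ∂P.prod Q =
      (1 - (charFun P ξ * (starRingEnd ℂ) (charFun Q ξ)).re) * fourierWeight E β ξ := by
    simp only [F]
    rw [integral_mul_const, integral_sub (integrable_const _), integral_cos_inner_sub_prod]
    · simp
    · exact Integrable.of_bound (C := 1) (by fun_prop)
        (.of_forall fun z => by simpa using Real.abs_cos_le_one _)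
  simp_rw [← hinner]
  refine ⟨hF.integral_prod_right, ?_⟩
  rw [← integral_prod_symm _ hF, integral_prod _ hF]
  simp only [F, hC]
  rw [integral_const_mul]

/-- The energy distance with exponent `β ∈ (0, 2)` separates probability measures with finite
`β`-th moment. -/
theorem eq_of_energyDistance_eq_zero (hβ : 0 < β) (hβ2 : β < 2)
    (P Q : Measure E) [IsProbabilityMeasure P] [IsProbabilityMeasure Q]
    (hP : Integrable (fun x => ‖x‖ ^ β) P) (hQ : Integrable (fun x => ‖x‖ ^ β) Q)
    (h : 2 * ∫ z : E × E, ‖z.1 - z.2‖ ^ β ∂P.prod Q =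
      (∫ z : E × E, ‖z.1 - z.2‖ ^ β ∂P.prod P) + ∫ z : E × E, ‖z.1 - z.2‖ ^ β ∂Q.prod Q) :
    P = Q := by
  refine Measure.ext_of_charFun ?_
  rcases subsingleton_or_nontrivial E with hE | hE
  · ext ξ
    simp [Subsingleton.elim ξ 0]
  obtain ⟨C, hC⟩ := exists_integral_one_sub_cos_inner_mul_fourierWeight (E := E) hβ
  obtain ⟨iPQ, ePQ⟩ := integral_rpow_norm_sub_prod_eq hβ hβ2 hC P Q hP hQ
  obtain ⟨iPP, ePP⟩ := integral_rpow_norm_sub_prod_eq hβ hβ2 hC P P hP hP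
  obtain ⟨iQQ, eQQ⟩ := integral_rpow_norm_sub_prod_eq hβ hβ2 hC Q Q hQ hQ
  have hsq (ξ : E) : ‖charFun P ξ - charFun Q ξ‖ ^ 2 * fourierWeight E β ξ =
      2 * ((1 - (charFun P ξ * (starRingEnd ℂ) (charFun Q ξ)).re) * fourierWeight E β ξ) -
      (1 - (charFun P ξ * (starRingEnd ℂ) (charFun P ξ)).re) * fourierWeight E β ξ -
      (1 - (charFun Q ξ * (starRingEnd ℂ) (charFun Q ξ)).re) * fourierWeight E β ξ := by
    rw [← Complex.normSq_eq_norm_sq, Complex.normSq_apply]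
    simp
    ring
  have hint : ∫ ξ : E, ‖charFun P ξ - charFun Q ξ‖ ^ 2 * fourierWeight E β ξ = 0 := by
    simp_rw [hsq]
    rw [integral_sub (by exact (iPQ.const_mul 2).sub iPP) iQQ, integral_sub (iPQ.const_mul 2) iPP,
      integral_const_mul, ePQ, ePP, eQQ]
    linear_combination C * h
  rw [integral_eq_zero_iff_of_nonneg
    (fun ξ => mul_nonneg (sq_nonneg _) (fourierWeight_nonneg ξ))
    (by simp_rw [hsq]; exact ((iPQ.const_mul 2).sub iPP).sub iQQ)] at hint
  refine (continuous_charFun.ae_eq_iff_eq volume continuous_charFun).1 ?_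
  filter_upwards [hint, Measure.ae_ne volume 0] with ξ hξ hξ0
  have hw : fourierWeight E β ξ ≠ 0 := (Real.rpow_pos_of_pos (norm_pos_iff.2 hξ0) _).ne'
  simpa [hw, sub_eq_zero] using hξ

end EnergyDistance

/-- `u ↦ √(uᵀ S u)` is the Euclidean norm after an injective linear map. -/
lemma Matrix.PosDef.exists_mahNorm_eq_norm {n : ℕ} {S : Matrix (Fin n) (Fin n) ℝ}
    (hS : S.PosDef) :
    ∃ A : EuclideanSpace ℝ (Fin n) →L[ℝ] EuclideanSpace ℝ (Fin n),
      Function.Injective A ∧ ∀ u, mahNorm S u = ‖A u‖ := by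
  obtain ⟨B, rfl⟩ : ∃ B : Matrix (Fin n) (Fin n) ℝ, S = Bᴴ * B := by
    open scoped MatrixOrder Matrix.Norms.L2Operator in
    exact CStarAlgebra.nonneg_iff_eq_star_mul_self.mp hS.posSemidef.nonneg
  have hA (u : EuclideanSpace ℝ (Fin n)) :
      (u : Fin n → ℝ) ⬝ᵥ (Bᴴ * B).mulVec u = ‖toEuclideanCLM (𝕜 := ℝ) B u‖ ^ 2 := by
    rw [← real_inner_self_eq_norm_sq, EuclideanSpace.inner_eq_star_dotProduct,
      ofLp_toEuclideanCLM, star_trivial, conjTranspose_eq_transpose_of_trivial,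
      ← mulVec_mulVec, dotProduct_mulVec, vecMul_transpose]
  refine ⟨toEuclideanCLM (𝕜 := ℝ) B, ?_, fun u => ?_⟩
  · refine (injective_iff_map_eq_zero _).2 fun u hu => ?_
    by_contra hu0
    have h := hS.dotProduct_mulVec_pos (x := (u : Fin n → ℝ)) (by simpa using hu0)
    rw [star_trivial, hA, hu] at h
    simp at h
  · rw [mahNorm, hA, Real.sqrt_sq (norm_nonneg _)]

/-- **Strict propriety of the Mahalanobis energy score for `β ∈ (0,2)`.** For a symmetric
positive definite `Σ` and Borel probability measures `P, Q` on ℝⁿ with finite `β`-th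
moments, equality of the expected energy scores `E_{y∼Q}[ES_{Σ⁻¹,β}(P,y)] =
E_{y∼Q}[ES_{Σ⁻¹,β}(Q,y)]` forces `P = Q`. -/
theorem mahalanobis_energy_score_strictly_proper
    {n : ℕ} (β : ℝ) (hβ : 0 < β) (hβ2 : β < 2)
    (Sig : Matrix (Fin n) (Fin n) ℝ) (hSig : Sig.PosDef)
    (P Q : Measure (EuclideanSpace ℝ (Fin n)))
    [IsProbabilityMeasure P] [IsProbabilityMeasure Q]
    (hP : Integrable (fun x => ‖x‖ ^ β) P)
    (hQ : Integrable (fun x => ‖x‖ ^ β) Q)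
    (heq : (∫ y, ES Sig⁻¹ β P y ∂Q) = ∫ y, ES Sig⁻¹ β Q y ∂Q) :
    P = Q := by
  obtain ⟨A, hAinj, hA⟩ := hSig.inv.exists_mahNorm_eq_norm
  have hβ0 : 0 ≤ β := hβ.le
  have hmeas : Measurable A := A.continuous.measurable
  have hmom (R : Measure (EuclideanSpace ℝ (Fin n))) (hR : Integrable (fun x => ‖x‖ ^ β) R) :
      Integrable (fun x => ‖x‖ ^ β) (R.map A) := by
    rw [integrable_map_measure (by fun_prop) hmeas.aemeasurable]
    refine (hR.const_mul (‖A‖ ^ β)).mono' (by fun_prop) (.of_forall fun x => ?_)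
    rw [Function.comp_apply, Real.norm_of_nonneg (by positivity),
      ← Real.mul_rpow (norm_nonneg _) (norm_nonneg _)]
    exact Real.rpow_le_rpow (norm_nonneg _) (A.le_opNorm x) hβ.le
  have hmap (R T : Measure (EuclideanSpace ℝ (Fin n))) [IsProbabilityMeasure R]
      [IsProbabilityMeasure T] (hR : Integrable (fun x => ‖x‖ ^ β) R)
      (hT : Integrable (fun x => ‖x‖ ^ β) T) :
      Integrable (fun z : EuclideanSpace ℝ (Fin n) × EuclideanSpace ℝ (Fin n) =>
        mahNorm Sig⁻¹ (z.1 - z.2) ^ β) (R.prod T) ∧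
      ∫ z, ‖z.1 - z.2‖ ^ β ∂(R.map A).prod (T.map A) =
        ∫ z, mahNorm Sig⁻¹ (z.1 - z.2) ^ β ∂(R.prod T) := by
    have := Measure.isProbabilityMeasure_map (μ := R) hmeas.aemeasurable
    have := Measure.isProbabilityMeasure_map (μ := T) hmeas.aemeasurable
    have hi := integrable_rpow_norm_sub_prod hβ.le _ _ (hmom R hR) (hmom T hT)
    rw [Measure.map_prod_map _ _ hmeas hmeas] at hi ⊢
    have hm : AEMeasurable (Prod.map A A) (R.prod T) := (hmeas.prodMap hmeas).aemeasurable
    rw [integral_map hm hi.1]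
    simp only [hA, map_sub]
    exact ⟨hi.comp_aemeasurable hm, rfl⟩
  have hself (R T : Measure (EuclideanSpace ℝ (Fin n))) [IsProbabilityMeasure R]
      [IsProbabilityMeasure T] (hR : Integrable (fun x => ‖x‖ ^ β) R)
      (hT : Integrable (fun x => ‖x‖ ^ β) T) :
      ∫ y, ES Sig⁻¹ β R y ∂T =
        (∫ z, ‖z.1 - z.2‖ ^ β ∂(R.map A).prod (T.map A)) -
          1 / 2 * ∫ z, ‖z.1 - z.2‖ ^ β ∂(R.map A).prod (R.map A) := by
    obtain ⟨hi, he⟩ := hmap R T hR hT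
    obtain ⟨hi2, he2⟩ := hmap R R hR hR
    rw [he, he2, integral_prod_symm _ hi, integral_prod _ hi2]
    unfold ES
    rw [integral_sub hi.integral_prod_right (integrable_const _)]
    simp
  rw [hself P Q hP hQ, hself Q Q hQ hQ] at heq
  have := Measure.isProbabilityMeasure_map (μ := P) hmeas.aemeasurable
  have := Measure.isProbabilityMeasure_map (μ := Q) hmeas.aemeasurable
  have hPQ : P.map A = Q.map A :=
    eq_of_energyDistance_eq_zero hβ hβ2 _ _ (hmom P hP) (hmom Q hQ) (by linarith)
  have hemb : MeasurableEmbedding A := A.continuous.measurableEmbedding hAinj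
  rw [← hemb.comap_map P, hPQ, hemb.comap_map]
end
end

section
/- Let p be a continuously differentiable probability density on ℝⁿ such that p and ∇p are bounded and uniformly continuous, and fix y ∈ ℝⁿ with p(y) > 0. Let q be a probability density on ℝⁿ (for example a generalized Gaussian density) with ∫ ‖u‖₂ q(u) du < ∞, and for ε > 0 set q_ε(u) = ε^{−n} q(u/ε). Then the score of the ε-noised marginal converges to the clean score: ∇ log (p * q_ε)(y) → ∇ log p(y) as ε → 0⁺, where (p * q_ε)(y) = ∫ p(x) q_ε(y−x) dx. -/
open MeasureTheory Filter

noncomputable section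

open scoped Topology

theorem integral_mul_rescaled_eq {E : Type*} [NormedAddCommGroup E] [NormedSpace ℝ E]
    [FiniteDimensional ℝ E] [MeasurableSpace E] [BorelSpace E] (μ : Measure E)
    [μ.IsAddHaarMeasure] (p q : E → ℝ) {ε : ℝ} (hε : 0 < ε) (z : E) :
    ∫ x, p x * ((ε ^ Module.finrank ℝ E)⁻¹ * q (ε⁻¹ • (z - x))) ∂μ
      = ∫ u, q u * p (z - ε • u) ∂μ := by
  rw [← integral_sub_left_eq_self _ μ z]
  have h := Measure.integral_comp_smul μ (fun x => q (ε⁻¹ • x) * p (z - x)) ε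
  simp only [inv_smul_smul₀ hε.ne', smul_eq_mul, abs_of_pos (inv_pos.2 (pow_pos hε _))] at h
  rw [h, ← integral_const_mul]
  congr 1 with x
  simp only [sub_sub_cancel]
  ring

theorem tendsto_integral_smul_comp_sub_smul {E F : Type*} [NormedAddCommGroup E]
    [NormedSpace ℝ E] [MeasurableSpace E] [BorelSpace E] [SecondCountableTopology E]
    [NormedAddCommGroup F] [NormedSpace ℝ F] [CompleteSpace F] {μ : Measure E}
    {q : E → ℝ} (hq : Integrable q μ) {f : E → F} (hf : Continuous f) {C : ℝ}
    (hC : ∀ x, ‖f x‖ ≤ C) (y : E) :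
    Tendsto (fun ε : ℝ => ∫ u, q u • f (y - ε • u) ∂μ) (𝓝 0) (𝓝 ((∫ u, q u ∂μ) • f y)) := by
  rw [← integral_smul_const]
  refine tendsto_integral_filter_of_dominated_convergence (fun u => ‖q u‖ * C)
    (Eventually.of_forall fun ε => ?_) (Eventually.of_forall fun ε => ?_) (hq.norm.mul_const C) ?_
  · exact hq.aestronglyMeasurable.smul
      (hf.comp (continuous_const.sub (continuous_const_smul ε))).aestronglyMeasurable
  · refine Eventually.of_forall fun u => ?_
    rw [norm_smul]
    exact mul_le_mul_of_nonneg_left (hC _) (norm_nonneg _)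
  · refine Eventually.of_forall fun u => ?_
    have h : Continuous fun ε : ℝ => q u • f (y - ε • u) := by fun_prop
    simpa using h.tendsto 0

theorem hasFDerivAt_integral_mul_comp_sub_smul {E : Type*} [NormedAddCommGroup E]
    [NormedSpace ℝ E] [MeasurableSpace E] [BorelSpace E]
    [SecondCountableTopology E] {μ : Measure E} {p q : E → ℝ} (hq : Integrable q μ)
    (hp : ContDiff ℝ 1 p) {B C : ℝ} (hB : ∀ x, ‖p x‖ ≤ B) (hC : ∀ x, ‖fderiv ℝ p x‖ ≤ C)
    (ε : ℝ) (y : E) :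
    HasFDerivAt (fun z => ∫ u, q u * p (z - ε • u) ∂μ)
      (∫ u, q u • fderiv ℝ p (y - ε • u) ∂μ) y := by
  have hsub (z : E) : Continuous fun u : E => z - ε • u := by fun_prop
  have hmeas (z : E) : AEStronglyMeasurable (fun u => q u * p (z - ε • u)) μ :=
    hq.aestronglyMeasurable.mul (hp.continuous.comp (hsub z)).aestronglyMeasurable
  refine hasFDerivAt_integral_of_dominated_of_fderiv_le
    (F' := fun z u => q u • fderiv ℝ p (z - ε • u))
    (bound := fun u => ‖q u‖ * C) univ_mem (Eventually.of_forall hmeas) ?_ ?_ ?_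
    (hq.norm.mul_const C) ?_
  · refine (hq.norm.mul_const B).mono' (hmeas y) (Eventually.of_forall fun u => ?_)
    rw [norm_mul]
    exact mul_le_mul_of_nonneg_left (hB _) (norm_nonneg _)
  · exact hq.aestronglyMeasurable.smul
      ((hp.continuous_fderiv one_ne_zero).comp (hsub y)).aestronglyMeasurable
  · refine Eventually.of_forall fun u z _ => ?_
    rw [norm_smul]
    exact mul_le_mul_of_nonneg_left (hC _) (norm_nonneg _)
  · refine Eventually.of_forall fun u z _ => ?_
    have h := (hp.differentiable one_ne_zero (z - ε • u)).hasFDerivAt.comp z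
      ((hasFDerivAt_id z).sub_const (ε • u))
    simpa using h.const_mul (q u)



/-- **Convergence of the noisy score to the clean score.** Let `p` be a `C¹` probability
density on ℝⁿ with `p` and `∇p` bounded and uniformly continuous, and `y` a point with
`p(y) > 0`. Let `q` be a probability density with finite first moment and
`q_ε(u) = ε^{-n} q(u/ε)`. Then `∇ log (p * q_ε)(y) → ∇ log p(y)` as `ε → 0⁺`. -/
theorem score_convergence_small_noise
    {n : ℕ}
    (p : EuclideanSpace ℝ (Fin n) → ℝ)
    (hp_nonneg : ∀ x, 0 ≤ p x) (hp_int : ∫ x, p x = 1)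
    (hp_smooth : ContDiff ℝ 1 p)
    (hp_bdd : ∃ C, ∀ x, p x ≤ C)
    (hp_uc : UniformContinuous p)
    (hgrad_bdd : ∃ C, ∀ x, ‖gradient p x‖ ≤ C)
    (hgrad_uc : UniformContinuous fun x => gradient p x)
    (y : EuclideanSpace ℝ (Fin n)) (hpy : 0 < p y)
    (q : EuclideanSpace ℝ (Fin n) → ℝ)
    (hq_nonneg : ∀ u, 0 ≤ q u) (hq_int : ∫ u, q u = 1)
    (hq_mom : Integrable fun u => ‖u‖ * q u) :
    Tendsto
      (fun ε : ℝ =>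
        gradient (fun z => Real.log (∫ x, p x * ((ε ^ n)⁻¹ * q (ε⁻¹ • (z - x))))) y)
      (nhdsWithin 0 (Set.Ioi 0))
      (nhds (gradient (fun z => Real.log (p z)) y)) := by
  obtain ⟨B, hB⟩ := hp_bdd
  obtain ⟨C, hC⟩ := hgrad_bdd
  have hB' (x) : ‖p x‖ ≤ B := by rw [Real.norm_of_nonneg (hp_nonneg x)]; exact hB x
  have hC' (x) : ‖fderiv ℝ p x‖ ≤ C := by
    simpa only [gradient, LinearIsometryEquiv.norm_map] using hC x
  have hq : Integrable q := by
    by_contra h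
    simp [integral_undef h] at hq_int
  have hval : Tendsto (fun ε : ℝ => ∫ u, q u * p (y - ε • u)) (𝓝[>] 0) (𝓝 (p y)) := by
    simpa [hq_int] using (tendsto_integral_smul_comp_sub_smul hq hp_smooth.continuous hB' y).mono_left
      nhdsWithin_le_nhds
  have hder : Tendsto (fun ε : ℝ => ∫ u, q u • fderiv ℝ p (y - ε • u)) (𝓝[>] 0)
      (𝓝 (fderiv ℝ p y)) := by
    simpa [hq_int] using (tendsto_integral_smul_comp_sub_smul hq
      (hp_smooth.continuous_fderiv one_ne_zero) hC' y).mono_left nhdsWithin_le_nhds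
  refine ((InnerProductSpace.toDual ℝ _).symm.continuous.tendsto _).comp ?_
  rw [fderiv.log (hp_smooth.differentiable one_ne_zero y) hpy.ne']
  refine ((hval.inv₀ hpy.ne').smul hder).congr' ?_
  filter_upwards [self_mem_nhdsWithin, hval.eventually_ne hpy.ne'] with ε hε hne
  have hconv (z) := integral_mul_rescaled_eq volume p q hε z
  simp only [finrank_euclideanSpace_fin] at hconv
  simp only [hconv]
  exact ((hasFDerivAt_integral_mul_comp_sub_smul hq hp_smooth hB' hC' ε y).log hne).fderiv.symm
end
end
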